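/- arXiv:2605.28781 — 4 statements merged into one kernel-verified Lean document; each statement's English description precedes it below -/
import Mathlib

section
/- If K is a totally real number field of degree d ≥ 2 over ℚ, then its regulator R_K is at most its discriminant: R_K ≤ Δ_K. -/
open NumberField

/-- A number field is totally real if every embedding into `ℂ` takes real values. -/
def TotallyReal (K : Type*) [Field K] : Prop :=
  ∀ φ : K →+* ℂ, ∀ x : K, (φ x).im = 0

theorem TotallyReal.isTotallyReal {K : Type*} [Field K] (h : TotallyReal K) : IsTotallyReal K where
  isReal v := by
    rw [InfinitePlace.isReal_iff, ComplexEmbedding.isReal_iff]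
    ext x
    exact Complex.conj_eq_iff_im.mpr (h v.embedding x)

open MeasureTheory in
/-- In dimension `m`, the corner simplex `{y > 0, ∑ y < T}` has volume at most `T ^ m / m!`. -/
theorem volume_corner_simplex_le {ι : Type*} [Fintype ι] [Nonempty ι] {T : ℝ} (hT : 0 < T) :
    volume {y : ι → ℝ | (∀ i, 0 < y i) ∧ ∑ i, y i < T} ≤
      ENNReal.ofReal (T ^ Fintype.card ι / (Fintype.card ι).factorial) := by
  classical
  set m := Fintype.card ι with hm
  set A : Set (ι → ℝ) := {y | (∀ i, 0 < y i) ∧ ∑ i, y i < T} with hA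
  have hAm : MeasurableSet A := by
    have : A = (⋂ i, {y : ι → ℝ | 0 < y i}) ∩ {y | ∑ i, y i < T} := by ext; simp [hA]
    rw [this]
    exact (MeasurableSet.iInter fun i ↦
      measurableSet_lt measurable_const (measurable_pi_apply i)).inter
      (measurableSet_lt (by fun_prop) measurable_const)
  let sgn : Bool → ℝ → ℝ := fun b t ↦ if b then t else -t
  let flip : (ι → Bool) → (ι → ℝ) → ι → ℝ := fun b y i ↦ sgn (b i) (y i)
  have hflip (b) : MeasurePreserving (flip b) volume volume := by
    refine volume_preserving_pi (f := fun i ↦ sgn (b i)) fun i ↦ ?_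
    cases b i
    · simpa [sgn] using! Measure.measurePreserving_neg (volume : Measure ℝ)
    · simpa [sgn] using! MeasurePreserving.id (volume : Measure ℝ)
  have hdisj : Pairwise (Function.onFun Disjoint fun b ↦ flip b ⁻¹' A) := by
    intro b c hbc
    refine Set.disjoint_left.mpr fun y hb hc ↦ hbc (funext fun i ↦ ?_)
    have h1 := hb.1 i
    have h2 := hc.1 i
    simp only [flip, sgn] at h1 h2
    cases h : b i <;> cases h' : c i <;> simp [h, h'] at h1 h2 ⊢ <;> linarith
  have hsub : (⋃ b, flip b ⁻¹' A) ⊆ {x : ι → ℝ | (∑ i, |x i| ^ (1 : ℝ)) ^ (1 / (1 : ℝ)) < T} := by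
    refine Set.iUnion_subset fun b y hy ↦ ?_
    have : ∀ i, |y i| = flip b y i := fun i ↦ by
      have h1 := hy.1 i
      simp only [flip, sgn] at h1 ⊢
      cases h : b i <;> simp [h] at h1 ⊢ <;> linarith
    simpa [this] using! hy.2
  have key := measure_mono (μ := volume) hsub
  rw [measure_iUnion hdisj fun b ↦ (hflip b).measurable hAm, volume_sum_rpow_lt ι le_rfl,
    tsum_fintype] at key
  simp only [(hflip _).measure_preimage hAm.nullMeasurableSet, Finset.sum_const, Finset.card_univ,
    Fintype.card_fun, Fintype.card_bool, ← hm, nsmul_eq_mul] at key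
  rw [← ENNReal.ofReal_pow hT.le, ← ENNReal.ofReal_mul (by positivity), div_one, div_one,
    one_add_one_eq_two, Real.Gamma_two, Real.Gamma_nat_eq_factorial, mul_one,
    show T ^ m * (2 ^ m / (m.factorial : ℝ)) = 2 ^ m * (T ^ m / m.factorial) by ring,
    ENNReal.ofReal_mul (by positivity)] at key
  refine (ENNReal.mul_le_mul_iff_right (a := 2 ^ m) (by simp) (by simp)).mp ?_
  simpa [ENNReal.ofReal_pow] using key

theorem two_mul_pow_div_factorial_le_exp {u : ℝ} (hu : 0 ≤ u) {m : ℕ} (hm : m ≠ 0) :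
    2 * (u ^ m / m.factorial) ≤ Real.exp u := by
  obtain ⟨n, rfl⟩ := Nat.exists_eq_succ_of_ne_zero hm
  have hsum := Real.sum_le_exp_of_nonneg hu (n + 3)
  rw [Finset.sum_range_succ, Finset.sum_range_succ, Finset.sum_range_succ] at hsum
  have h0 : 0 ≤ ∑ i ∈ Finset.range n, u ^ i / (i.factorial : ℝ) := by positivity
  have h1 : u ^ (n + 1) / ((n + 1).factorial : ℝ) ≤
      u ^ n / (n.factorial : ℝ) + u ^ (n + 2) / ((n + 2).factorial : ℝ) := by
    have hn : (0 : ℝ) ≤ n := n.cast_nonneg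
    have e : u ^ n / (n.factorial : ℝ) + u ^ (n + 2) / ((n + 2).factorial : ℝ) -
        u ^ (n + 1) / ((n + 1).factorial : ℝ) =
        u ^ n / ((n + 2).factorial : ℝ) * ((n + 2) * (n + 1) + u ^ 2 - (n + 2) * u) := by
      rw [Nat.factorial_succ (n + 1), Nat.factorial_succ n]
      have := n.factorial_ne_zero
      push_cast
      field_simp
      ring
    have : 0 ≤ u ^ n / ((n + 2).factorial : ℝ) * ((n + 2) * (n + 1) + u ^ 2 - (n + 2) * u) := by
      refine mul_nonneg (by positivity) ?_
      nlinarith [sq_nonneg (u - (n + 2) / 2)]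
    linarith
  simp only [Nat.succ_eq_add_one]
  linarith

open MeasureTheory in
theorem volume_corner_simplex_le_exp {ι : Type*} [Fintype ι] [Nonempty ι] (T : ℝ) :
    volume {y : ι → ℝ | (∀ i, 0 < y i) ∧ ∑ i, y i < T} ≤
      ENNReal.ofReal (Real.exp (2 * T) / 2 ^ (Fintype.card ι + 1)) := by
  rcases le_or_gt T 0 with hT | hT
  · have : {y : ι → ℝ | (∀ i, 0 < y i) ∧ ∑ i, y i < T} = ∅ := by
      refine Set.eq_empty_of_forall_notMem fun y hy ↦ ?_
      have : 0 ≤ ∑ i, y i := Finset.sum_nonneg fun i _ ↦ (hy.1 i).le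
      linarith [hy.2]
    simp [this]
  · refine (volume_corner_simplex_le hT).trans (ENNReal.ofReal_le_ofReal ?_)
    rw [le_div_iff₀ (by positivity)]
    refine le_trans (le_of_eq ?_) (two_mul_pow_div_factorial_le_exp (u := 2 * T) (by positivity)
      (m := Fintype.card ι) Fintype.card_ne_zero)
    rw [mul_pow, pow_succ]
    ring

open MeasureTheory Module in
/-- The covolume of a lattice is at most the volume of any set whose translates cover the space. -/
theorem ZLattice.ofReal_covolume_le_of_cover {ι : Type*} [Fintype ι] (L : Submodule ℤ (ι → ℝ))
    [DiscreteTopology L] [IsZLattice ℝ L] (S : Set (ι → ℝ))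
    (hS : ∀ x : ι → ℝ, ∃ g ∈ L, x - g ∈ S) :
    ENNReal.ofReal (ZLattice.covolume L) ≤ volume S := by
  have h := ZLattice.isAddFundamentalDomain (Free.chooseBasis ℤ L) (volume : Measure (ι → ℝ))
  set F := ZSpan.fundamentalDomain ((Free.chooseBasis ℤ L).ofZLatticeBasis ℝ L)
  have hfin : volume F ≠ ⊤ := (ZSpan.fundamentalDomain_isBounded _).measure_lt_top.ne
  rw [ZLattice.covolume_eq_measure_fundamentalDomain L volume h, ofReal_measureReal hfin]
  have : MeasurableVAdd L (ι → ℝ) :=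
    (inferInstance : MeasurableVAdd L.toAddSubgroup (ι → ℝ))
  have : VAddInvariantMeasure L (ι → ℝ) volume :=
    (inferInstance : VAddInvariantMeasure L.toAddSubgroup (ι → ℝ) volume)
  rw [h.measure_eq_tsum S]
  refine (measure_mono ?_).trans (measure_iUnion_le _)
  intro x hx
  obtain ⟨g, hg, hx'⟩ := hS x
  refine Set.mem_iUnion.mpr ⟨⟨g, hg⟩, Set.mem_vadd_set.mpr ⟨x - g, hx', ?_⟩, hx⟩
  simp [Submodule.vadd_def]

open InfinitePlace mixedEmbedding MeasureTheory ENNReal NNReal in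
/-- Minkowski's linear forms theorem for the ring of integers of a totally real field. -/
theorem exists_ne_zero_lt_of_sqrt_discr_lt_prod (K : Type*) [Field K] [NumberField K]
    [IsTotallyReal K] (f : InfinitePlace K → ℝ≥0)
    (hf : √((discr K).natAbs : ℝ) < ∏ w, (f w : ℝ)) :
    ∃ a : 𝓞 K, a ≠ 0 ∧ ∀ w : InfinitePlace K, w a < f w := by
  classical
  refine exists_ne_zero_mem_ringOfIntegers_lt K ?_
  rw [minkowskiBound, volume_fundamentalDomain_fractionalIdealLatticeBasis,
    volume_fundamentalDomain_latticeBasis, convexBodyLT_volume, mixedEmbedding.finrank,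
    IsTotallyReal.finrank, IsTotallyReal.nrComplexPlaces_eq_zero]
  have h : NNReal.sqrt ‖discr K‖₊ < ∏ w, f w := by
    rw [← NNReal.coe_lt_coe]
    simpa [Int.norm_eq_abs, Nat.cast_natAbs] using hf
  simp only [Units.val_one, FractionalIdeal.absNorm_one, Rat.cast_one, ENNReal.ofReal_one, one_mul,
    pow_zero, mul_one, convexBodyLTFactor, IsTotallyReal.nrComplexPlaces_eq_zero,
    IsTotallyReal.mult_eq, pow_one]
  rw [mul_comm]
  push_cast
  refine ENNReal.mul_lt_mul_right (by simp) (by simp) ?_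
  exact_mod_cast h

/-- A colouring of the ideals of `𝓞 K` by `[K : ℚ]` colours separating the primes above each
rational prime. -/
theorem exists_colouring_injOn_primesOver (K : Type*) [Field K] [NumberField K] :
    ∃ c : Ideal (𝓞 K) → Fin (Module.finrank ℚ K), ∀ P Q : Ideal (𝓞 K), P.IsPrime → Q.IsPrime →
      P.under ℤ = Q.under ℤ → c P = c Q → P = Q := by
  classical
  have : NeZero (Module.finrank ℚ K) := ⟨Module.finrank_pos.ne'⟩
  have key (p : Ideal ℤ) : ∃ e : Ideal (𝓞 K) → Fin (Module.finrank ℚ K),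
      p.IsPrime → Set.InjOn e (p.primesOver (𝓞 K)) := by
    by_cases hp : p.IsPrime
    swap
    · exact ⟨fun _ ↦ 0, fun h ↦ absurd h hp⟩
    have : Fintype (p.primesOver (𝓞 K)) := (Algebra.QuasiFinite.finite_primesOver p).fintype
    have hcard : Fintype.card (p.primesOver (𝓞 K)) ≤ Fintype.card (Fin (Module.finrank ℚ K)) := by
      rw [Fintype.card_fin, ← RingOfIntegers.rank K,
        ← Ideal.sum_ramification_inertia_eq_finrank p (𝓞 K), Fintype.card_eq_sum_ones]
      refine Finset.sum_le_sum fun P _ ↦ ?_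
      have : P.1.IsPrime := P.2.1
      exact Nat.mul_pos (P.1.ramificationIdx_pos ℤ) (P.1.inertiaDeg_pos ℤ)
    obtain ⟨f⟩ := Function.Embedding.nonempty_of_card_le hcard
    refine ⟨fun P ↦ if h : P ∈ p.primesOver (𝓞 K) then f ⟨P, h⟩ else 0, fun _ P hP Q hQ h ↦ ?_⟩
    simpa [hP, hQ] using h
  choose e he using key
  refine ⟨fun P ↦ e (P.under ℤ) P, fun P Q hP hQ hPQ h ↦ ?_⟩
  have hQ' : Q ∈ (P.under ℤ).primesOver (𝓞 K) := ⟨hQ, ⟨hPQ⟩⟩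
  refine he (P.under ℤ) inferInstance ⟨hP, ⟨rfl⟩⟩ hQ' ?_
  simpa [hPQ] using h

theorem Multiset.prod_map_filter_eq {α ι M : Type*} [Fintype ι] [DecidableEq ι] [CommMonoid M]
    (c : α → ι) (q : α → M) (s : Multiset α) :
    ∏ i, ((s.filter fun a ↦ c a = i).map q).prod = (s.map q).prod := by
  induction s using Multiset.induction with
  | empty => simp
  | cons a s ih =>
    simp only [Multiset.filter_cons, Multiset.map_add, Multiset.prod_add, Finset.prod_mul_distrib,
      ih, Multiset.map_cons, Multiset.prod_cons]
    congr 1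
    rw [Finset.prod_eq_single (c a)]
    · simp
    · intro b _ hb
      simp [hb.symm]
    · simp

open UniqueFactorizationMonoid in
/-- A partial sum of `ζ_K(2)` is at most `2 ^ [K : ℚ]`. -/
theorem sum_inv_absNorm_sq_le (K : Type*) [Field K] [NumberField K] (t : Finset (Ideal (𝓞 K)))
    (ht : ∀ I ∈ t, I ≠ ⊥) :
    ∑ I ∈ t, ((Ideal.absNorm I : ℝ) ^ 2)⁻¹ ≤ 2 ^ Module.finrank ℚ K := by
  classical
  obtain ⟨c, hc⟩ := exists_colouring_injOn_primesOver K
  let q : Ideal (𝓞 K) → ℕ := fun P ↦ Ideal.absNorm (P.under ℤ)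
  let A : Ideal (𝓞 K) → Fin (Module.finrank ℚ K) → Multiset ℕ := fun I i ↦
    ((normalizedFactors I).filter fun P ↦ c P = i).map q
  let n : Ideal (𝓞 K) → Fin (Module.finrank ℚ K) → ℕ := fun I i ↦ (A I i).prod
  have hprime {I P : Ideal (𝓞 K)} (hP : P ∈ normalizedFactors I) : P.IsPrime :=
    Ideal.isPrime_of_prime (prime_of_normalized_factor P hP)
  have hq {I P : Ideal (𝓞 K)} (hP : P ∈ normalizedFactors I) : (q P).Prime := by
    have := hprime hP
    have : NeZero P := ⟨(prime_of_normalized_factor P hP).ne_zero⟩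
    exact Nat.absNorm_under_prime P
  have hA {I i} : ∀ p ∈ A I i, p.Prime := by
    intro p hp
    obtain ⟨P, hP, rfl⟩ := Multiset.mem_map.mp hp
    exact hq (Multiset.mem_filter.mp hP).1
  have hn_pos (I i) : 0 < n I i :=
    Nat.pos_of_ne_zero (Multiset.prod_ne_zero fun h ↦ (hA 0 h).ne_zero rfl)
  have hn_dvd {I} (hI : I ∈ t) : ∏ i, n I i ∣ Ideal.absNorm I := by
    have h1 : Ideal.absNorm I = ((normalizedFactors I).map Ideal.absNorm).prod := by
      conv_lhs => rw [← Ideal.prod_normalizedFactors_eq_self (ht I hI)]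
      exact map_multiset_prod _ _
    rw [h1]
    simp only [n, A, Multiset.prod_map_filter_eq]
    exact Multiset.prod_dvd_prod_of_dvd _ _ fun P _ ↦ Int.absNorm_under_dvd_absNorm P
  have hI_pos {I} (hI : I ∈ t) : 0 < Ideal.absNorm I :=
    Nat.pos_of_ne_zero (Ideal.absNorm_eq_zero_iff.not.mpr (ht I hI))
  have hcount {I P : Ideal (𝓞 K)} (hP : P.IsPrime) :
      (A I (c P)).count (q P) = (normalizedFactors I).count P := by
    rw [Multiset.count_map, Multiset.filter_filter, Multiset.count_eq_card_filter_eq]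
    congr 1
    refine Multiset.filter_congr fun Q hQ ↦ ⟨fun h ↦ ?_, by rintro rfl; simp⟩
    refine hc P Q hP (hprime hQ) ?_ h.2.symm
    rw [← Int.ideal_span_absNorm_eq_self (P.under ℤ), ← Int.ideal_span_absNorm_eq_self (Q.under ℤ)]
    exact congr_arg (fun m : ℕ ↦ Ideal.span {(m : ℤ)}) h.1
  have hinj : Set.InjOn n t := by
    intro I hI J hJ h
    have hAeq : A I = A J := by
      funext i
      rw [← normalizedFactors_prod_of_prime fun p hp ↦ (hA (I := I) (i := i) p hp).prime,
        ← normalizedFactors_prod_of_prime fun p hp ↦ (hA (I := J) (i := i) p hp).prime]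
      exact congr_arg normalizedFactors (congr_fun h i)
    rw [← Ideal.prod_normalizedFactors_eq_self (ht I hI),
      ← Ideal.prod_normalizedFactors_eq_self (ht J hJ)]
    congr 1
    ext P
    by_cases hP : P.IsPrime
    · rw [← hcount hP, ← hcount hP, hAeq]
    · rw [Multiset.count_eq_zero_of_notMem fun h ↦ hP (hprime h),
        Multiset.count_eq_zero_of_notMem fun h ↦ hP (hprime h)]
  let B := t.sup Ideal.absNorm
  calc ∑ I ∈ t, ((Ideal.absNorm I : ℝ) ^ 2)⁻¹
      ≤ ∑ I ∈ t, ∏ i, ((n I i : ℝ) ^ 2)⁻¹ := by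
        refine Finset.sum_le_sum fun I hI ↦ ?_
        rw [Finset.prod_inv_distrib, Finset.prod_pow, ← Nat.cast_prod]
        have : 0 < ∏ i, n I i := Finset.prod_pos fun i _ ↦ hn_pos I i
        have := Nat.le_of_dvd (hI_pos hI) (hn_dvd hI)
        gcongr
    _ = ∑ v ∈ t.image n, ∏ i, ((v i : ℝ) ^ 2)⁻¹ :=
        (Finset.sum_image (f := fun v ↦ ∏ i, ((v i : ℝ) ^ 2)⁻¹) hinj).symm
    _ ≤ ∑ v ∈ Fintype.piFinset fun _ : Fin (Module.finrank ℚ K) ↦ Finset.Icc 1 B,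
          ∏ i, ((v i : ℝ) ^ 2)⁻¹ := by
        refine Finset.sum_le_sum_of_subset_of_nonneg ?_ fun _ _ _ ↦ by positivity
        intro v hv
        obtain ⟨I, hI, rfl⟩ := Finset.mem_image.mp hv
        refine Fintype.mem_piFinset.mpr fun i ↦ Finset.mem_Icc.mpr ⟨hn_pos I i, ?_⟩
        refine (Nat.le_of_dvd (hI_pos hI) ?_).trans (Finset.le_sup hI)
        exact (Finset.dvd_prod_of_mem _ (Finset.mem_univ i)).trans (hn_dvd hI)
    _ = (∑ k ∈ Finset.Icc 1 B, ((k : ℝ) ^ 2)⁻¹) ^ Module.finrank ℚ K := by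
        rw [← Finset.prod_univ_sum (fun _ : Fin (Module.finrank ℚ K) ↦ Finset.Icc 1 B)
          fun _ k ↦ ((k : ℝ) ^ 2)⁻¹]
        simp
    _ ≤ 2 ^ Module.finrank ℚ K := by
        gcongr
        have h := hasSum_zeta_two
        have h2 := sum_le_hasSum (Finset.Icc 1 B) (fun _ _ ↦ by positivity) h
        simp only [one_div] at h2
        nlinarith [Real.pi_lt_d2, Real.pi_pos]

open InfinitePlace in
theorem prod_infinitePlace_eq_absNorm_span (K : Type*) [Field K] [NumberField K]
    [IsTotallyReal K] (a : 𝓞 K) :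
    ∏ w : InfinitePlace K, w a = (Ideal.absNorm (Ideal.span {a}) : ℝ) := by
  have h := prod_eq_abs_norm (K := K) (a : K)
  simp only [IsTotallyReal.mult_eq, pow_one] at h
  rw [h, Ideal.absNorm_span_singleton, ← Algebra.coe_norm_int]
  simp [Nat.cast_natAbs]

open InfinitePlace NumberField.Units NumberField.Units.dirichletUnitTheorem in
/-- Up to a unit, every point of the logarithmic space lies in a corner simplex attached to a
nonzero integer. -/
theorem exists_sub_logEmbedding_mem_corner_simplex (K : Type*) [Field K] [NumberField K]
    [IsTotallyReal K] [Fintype {w : InfinitePlace K // w ≠ w₀}] {X : ℝ}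
    (hX : √((discr K).natAbs : ℝ) < X) (x : logSpace K) :
    ∃ a : 𝓞 K, a ≠ 0 ∧ (Ideal.absNorm (Ideal.span {a}) : ℝ) ≤ X ∧
      (∀ w : {w : InfinitePlace K // w ≠ w₀}, 0 < x w - Real.log (w.1 a)) ∧
      ∑ w, (x w - Real.log (w.1 a)) < Real.log (X / Ideal.absNorm (Ideal.span {a})) := by
  classical
  have hX0 : 0 < X := (Real.sqrt_nonneg _).trans_lt hX
  let f : InfinitePlace K → NNReal := fun w ↦
    if h : w ≠ w₀ then ⟨Real.exp (x ⟨w, h⟩), by positivity⟩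
    else ⟨X * Real.exp (-∑ w, x w), by positivity⟩
  have hf (w : {w : InfinitePlace K // w ≠ w₀}) : (f w : ℝ) = Real.exp (x w) := by
    simp [f, w.2]
    rfl
  have hf₀ : (f w₀ : ℝ) = X * Real.exp (-∑ w, x w) := by
    simp [f]
    rfl
  have hprod : ∏ w, (f w : ℝ) = X := by
    rw [Fintype.prod_eq_mul_prod_subtype_ne _ w₀, hf₀]
    have : ∏ w : {w : InfinitePlace K // w ≠ w₀}, (f w : ℝ) = Real.exp (∑ w, x w) := by
      rw [Real.exp_sum]
      exact Fintype.prod_congr _ _ hf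
    trans X * Real.exp (-∑ w, x w) * Real.exp (∑ w, x w)
    · rw [← this]
      congr!
    · rw [mul_assoc, ← Real.exp_add]
      simp
  obtain ⟨a, ha, hlt⟩ := exists_ne_zero_lt_of_sqrt_discr_lt_prod K f (by rwa [hprod])
  have hpos (w : InfinitePlace K) : 0 < w a :=
    InfinitePlace.pos_iff.mpr (RingOfIntegers.coe_ne_zero_iff.mpr ha)
  have hN := prod_infinitePlace_eq_absNorm_span K a
  refine ⟨a, ha, ?_, fun w ↦ ?_, ?_⟩
  · rw [← hN, ← hprod]
    exact Finset.prod_le_prod (fun w _ ↦ (hpos w).le) fun w _ ↦ (hlt w).le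
  · have := hlt w
    rw [hf] at this
    linarith [(Real.log_lt_iff_lt_exp (hpos w)).mpr this]
  · have h0 := Real.log_lt_log (hpos w₀) (hlt w₀)
    rw [hf₀, Real.log_mul hX0.ne' (Real.exp_ne_zero _), Real.log_exp] at h0
    have hlogN : Real.log (Ideal.absNorm (Ideal.span {a}) : ℝ) = Real.log (w₀ (a : K)) +
        ∑ w : {w : InfinitePlace K // w ≠ w₀}, Real.log (w.1 a) := by
      rw [← hN, Real.log_prod fun w _ ↦ (hpos w).ne', Fintype.sum_eq_add_sum_subtype_ne _ w₀]
      congr!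
    have hN0 : (Ideal.absNorm (Ideal.span {a}) : ℝ) ≠ 0 := by
      rw [← hN]
      exact Finset.prod_ne_zero_iff.mpr fun w _ ↦ (hpos w).ne'
    rw [Real.log_div hX0.ne' hN0, hlogN, Finset.sum_sub_distrib]
    linarith

open InfinitePlace NumberField.Units NumberField.Units.dirichletUnitTheorem MeasureTheory in
/-- The regulator is at most `X ^ 2` for every `X` exceeding the square root of the
discriminant. -/
theorem regulator_le_sq_of_sqrt_discr_lt (K : Type*) [Field K] [NumberField K]
    [IsTotallyReal K] (hd : 2 ≤ Module.finrank ℚ K) {X : ℝ}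
    (hX : √((discr K).natAbs : ℝ) < X) : regulator K ≤ X ^ 2 := by
  classical
  have hX0 : 0 < X := (Real.sqrt_nonneg _).trans_lt hX
  have hcard : Fintype.card {w : InfinitePlace K // w ≠ w₀} + 1 = Module.finrank ℚ K := by
    rw [IsTotallyReal.finrank, Fintype.card_subtype_compl, Fintype.card_subtype_eq,
      card_eq_nrRealPlaces_add_nrComplexPlaces, IsTotallyReal.nrComplexPlaces_eq_zero, add_zero]
    have := IsTotallyReal.finrank (K := K)
    omega
  have : Nonempty {w : InfinitePlace K // w ≠ w₀} :=
    Fintype.card_pos_iff.mp (by omega)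
  have hgen (I : Ideal (𝓞 K)) : ∃ b : 𝓞 K, (∃ a, I = Ideal.span {a}) → I = Ideal.span {b} := by
    by_cases h : ∃ a, I = Ideal.span {a}
    · exact ⟨h.choose, fun _ ↦ h.choose_spec⟩
    · exact ⟨0, fun h' ↦ absurd h' h⟩
  choose b hb using hgen
  let t : Finset (Ideal (𝓞 K)) :=
    (Ideal.finite_setOfPred_absNorm_le (S := 𝓞 K) ⌊X⌋₊).toFinset.filter fun I ↦ I ≠ ⊥
  let corner : ℝ → Set (logSpace K) := fun T ↦ {y | (∀ w, 0 < y w) ∧ ∑ w, y w < T}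
  let ℓ : 𝓞 K → logSpace K := fun a w ↦ Real.log (w.1 a)
  let T : Ideal (𝓞 K) → ℝ := fun I ↦ Real.log (X / Ideal.absNorm I)
  let S : Set (logSpace K) := ⋃ I ∈ t, (fun x ↦ x + -ℓ (b I)) ⁻¹' corner (T I)
  have hcover (x : logSpace K) : ∃ g ∈ unitLattice K, x - g ∈ S := by
    obtain ⟨a, ha, haX, hpos, hsum⟩ := exists_sub_logEmbedding_mem_corner_simplex K hX x
    obtain ⟨u, hu⟩ := Ideal.span_singleton_eq_span_singleton.mp (hb (Ideal.span {a}) ⟨a, rfl⟩).symm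
    refine ⟨logEmbedding K (Additive.ofMul u), ⟨Additive.ofMul u, trivial, rfl⟩, ?_⟩
    have hb0 : b (Ideal.span {a}) ≠ 0 := by
      intro h
      rw [h, zero_mul] at hu
      exact ha hu.symm
    have hx : x - logEmbedding K (Additive.ofMul u) + -ℓ (b (Ideal.span {a})) = x - ℓ a := by
      ext w
      have : Real.log (w.1 a) = Real.log (w.1 (b (Ideal.span {a}))) + Real.log (w.1 u) := by
        rw [← Real.log_mul, ← map_mul, ← map_mul, hu]
        · simpa using hb0
        · simp
      simp only [Pi.add_apply, Pi.sub_apply, Pi.neg_apply, logEmbedding_component,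
        IsTotallyReal.mult_eq, Nat.cast_one, one_mul, ℓ, this]
      ring
    refine Set.mem_biUnion (x := Ideal.span {a}) ?_ ?_
    · simpa [t, ha] using! Nat.le_floor haX
    · rw [Set.mem_preimage, hx]
      exact ⟨hpos, hsum⟩
  have hvol : volume S ≤ ENNReal.ofReal (X ^ 2) := by
    have ht : ∀ I ∈ t, I ≠ ⊥ := fun I hI ↦ (Finset.mem_filter.mp hI).2
    calc volume S ≤ ∑ I ∈ t, volume ((fun x ↦ x + -ℓ (b I)) ⁻¹' corner (T I)) :=
          measure_biUnion_finset_le t _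
      _ ≤ ∑ I ∈ t, ENNReal.ofReal
            (X ^ 2 / 2 ^ Module.finrank ℚ K * ((Ideal.absNorm I : ℝ) ^ 2)⁻¹) := by
          refine Finset.sum_le_sum fun I hI ↦ ?_
          rw [measure_preimage_add_right]
          refine (volume_corner_simplex_le_exp (T I)).trans (ENNReal.ofReal_le_ofReal (le_of_eq ?_))
          have hN : (0 : ℝ) < Ideal.absNorm I :=
            Nat.cast_pos.mpr (Nat.pos_of_ne_zero (Ideal.absNorm_eq_zero_iff.not.mpr (ht I hI)))
          rw [hcard, mul_comm 2, ← Nat.cast_ofNat (R := ℝ), Real.exp_mul,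
            Real.exp_log (by positivity), Real.rpow_natCast]
          field_simp
      _ = ENNReal.ofReal
            (X ^ 2 / 2 ^ Module.finrank ℚ K * ∑ I ∈ t, ((Ideal.absNorm I : ℝ) ^ 2)⁻¹) := by
          rw [Finset.mul_sum, ENNReal.ofReal_sum_of_nonneg fun _ _ ↦ by positivity]
      _ ≤ ENNReal.ofReal (X ^ 2) := by
          refine ENNReal.ofReal_le_ofReal ?_
          rw [div_mul_eq_mul_div, div_le_iff₀ (by positivity)]
          gcongr
          exact sum_inv_absNorm_sq_le K t ht
  refine (ENNReal.ofReal_le_ofReal_iff (by positivity)).mp (le_trans ?_ hvol)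
  rw [regulator]
  convert! ZLattice.ofReal_covolume_le_of_cover (unitLattice K) S hcover

/-- If `K` is a totally real number field of degree `d ≥ 2` then its regulator is at
most its (absolute) discriminant. -/
theorem statement10 (K : Type*) [Field K] [NumberField K]
    (htr : TotallyReal K) (hd : 2 ≤ Module.finrank ℚ K) :
    NumberField.Units.regulator K ≤ ((NumberField.discr K).natAbs : ℝ) := by
  have := htr.isTotallyReal
  have hR := (Units.regulator_pos K).le
  rw [← Real.sqrt_le_sqrt_iff (by positivity)]
  refine le_of_forall_gt_imp_ge_of_dense fun X hX ↦ Real.sqrt_le_iff.mpr ⟨?_, ?_⟩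
  · exact (Real.sqrt_nonneg _).trans hX.le
  · exact regulator_le_sq_of_sqrt_discr_lt K hd hX
end

section
/- Let K be a totally real number field of degree d over ℚ. For any real X ≥ 1, the set B^+(X) is finite and X^d·Δ_K^{−1/2} ≤ |B^+(X)| ≤ (2X+1)^d. -/
open NumberField

open MeasureTheory in
/-- If every orbit meets `s` in at most `N` points (counted with group elements), then the measure
of `s` is at most `N` times the measure of a fundamental domain. -/
theorem MeasureTheory.IsAddFundamentalDomain.measure_le_mul_of_ncard_le
    {G α : Type*} [AddGroup G] [Countable G] [AddAction G α] [MeasurableSpace α]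
    [MeasurableConstVAdd G α] {μ : Measure α} [VAddInvariantMeasure G α μ] {F s : Set α}
    (hF : IsAddFundamentalDomain G F μ) (hs : MeasurableSet s) (N : ℕ)
    (hN : ∀ x : α, {g : G | g +ᵥ x ∈ s}.Finite ∧ {g : G | g +ᵥ x ∈ s}.ncard ≤ N) :
    μ s ≤ N * μ F := by
  classical
  calc μ s = ∫⁻ x, s.indicator 1 x ∂μ := (lintegral_indicator_one hs).symm
    _ = ∑' g : G, ∫⁻ x in F, s.indicator 1 (g +ᵥ x) ∂μ := hF.lintegral_eq_tsum'' _
    _ = ∫⁻ x in F, ∑' g : G, s.indicator 1 (g +ᵥ x) ∂μ := by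
      refine (lintegral_tsum fun g => ?_).symm
      exact ((measurable_one.indicator hs).comp (measurable_const_vadd g)).aemeasurable
    _ ≤ ∫⁻ _ in F, (N : ENNReal) ∂μ := by
      refine lintegral_mono fun x => ?_
      rw [ENNReal.tsum_eq_iSup_sum]
      refine iSup_le fun t => ?_
      have hcard : (t.filter fun g => g +ᵥ x ∈ s).card ≤ N := by
        rw [← Set.ncard_coe_finset]
        exact (Set.ncard_le_ncard (by intro g; simp) (hN x).1).trans (hN x).2
      simpa [Set.indicator_apply, Finset.sum_boole] using
        (Nat.cast_le (α := ENNReal)).mpr hcard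
    _ = N * μ F := by simp

namespace NumberField

variable {K : Type*} [Field K]

theorem TotallyReal.isTotallyReal (h : TotallyReal K) : IsTotallyReal K where
  isReal w := by
    rw [InfinitePlace.isReal_iff, ComplexEmbedding.isReal_iff]
    ext x
    exact Complex.conj_eq_iff_im.mpr (h _ x)

theorem forall_infinitePlace_le_iff_forall_real [IsTotallyReal K] (x : K) (r : ℝ) :
    (∀ w : InfinitePlace K, w x ≤ r) ↔ ∀ σ : K →+* ℝ, |σ x| ≤ r := by
  constructor
  · intro h σ
    simpa [InfinitePlace.apply] using h (InfinitePlace.mk (Complex.ofRealHom.comp σ))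
  · intro h w
    have hw := IsTotallyReal.isReal w
    have := h (InfinitePlace.embedding_of_isReal hw)
    rwa [← InfinitePlace.norm_embedding_of_isReal hw, Real.norm_eq_abs]

variable [NumberField K]

open scoped Classical in
theorem mixedEmbedding.norm_le_iff (x : K) (r : ℝ) :
    ‖mixedEmbedding K x‖ ≤ r ↔ ∀ w : InfinitePlace K, w x ≤ r := by
  classical
  simp [norm_eq_sup'_normAtPlace, Finset.sup'_le_iff]

open scoped Classical in
theorem RingOfIntegers.one_le_norm_mixedEmbedding {a : 𝓞 K} (ha : a ≠ 0) :
    1 ≤ ‖mixedEmbedding K a‖ := by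
  by_contra! h
  have hlt (w : InfinitePlace K) : w a < 1 :=
    ((mixedEmbedding.norm_le_iff _ _).mp le_rfl w).trans_lt h
  obtain ⟨w⟩ : Nonempty (InfinitePlace K) := inferInstance
  exact (InfinitePlace.one_le_of_lt_one ha fun z _ => hlt z).not_gt (hlt w)

open scoped Classical in
theorem RingOfIntegers.finite_setOf_norm_mixedEmbedding_le (r : ℝ) :
    {a : 𝓞 K | ‖mixedEmbedding K a‖ ≤ r}.Finite := by
  refine ((Embeddings.finite_of_norm_le K ℂ r).preimage
    RingOfIntegers.coe_injective.injOn).subset fun a ha => ?_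
  exact ⟨RingOfIntegers.isIntegral_coe a, fun φ =>
    (mixedEmbedding.norm_le_iff _ _).mp ha (InfinitePlace.mk φ)⟩

open MeasureTheory Module

open scoped Classical in
theorem mixedEmbedding.volume_ball_of_isTotallyReal [IsTotallyReal K] (x : mixedSpace K) {r : ℝ}
    (hr : 0 < r) :
    volume (Metric.ball x r) = ENNReal.ofReal ((2 * r) ^ finrank ℚ K) := by
  lift r to NNReal using hr.le
  have hball : Metric.ball (0 : mixedSpace K) r = convexBodyLT K fun _ => r := by
    rw [convexBodyLT, ← ball_pi _ hr, ← ball_pi _ hr, ball_prod_same]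
    rfl
  rw [Measure.addHaar_ball_center, hball, convexBodyLT_volume]
  simp [IsTotallyReal.finrank, InfinitePlace.card_eq_nrRealPlaces_add_nrComplexPlaces, mul_pow]

open scoped Classical in
/-- Balls of radius `1 / 2` around the algebraic integers are disjoint. -/
theorem RingOfIntegers.ncard_setOf_norm_mixedEmbedding_le [IsTotallyReal K] {r : ℝ} (hr : 0 ≤ r) :
    ({a : 𝓞 K | ‖mixedEmbedding K a‖ ≤ r}.ncard : ℝ) ≤ (2 * r + 1) ^ finrank ℚ K := by
  classical
  have hfin := finite_setOf_norm_mixedEmbedding_le (K := K) r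
  set B := {a : 𝓞 K | ‖mixedEmbedding K a‖ ≤ r}
  have hdisj : (hfin.toFinset : Set (𝓞 K)).PairwiseDisjoint
      fun a => Metric.ball (mixedEmbedding K a) (1 / 2) := by
    intro a _ b _ hab
    refine Metric.ball_disjoint_ball ?_
    rw [dist_eq_norm, ← map_sub]
    have := one_le_norm_mixedEmbedding (sub_ne_zero.mpr hab)
    push_cast at this
    linarith
  have hsub : (⋃ a ∈ hfin.toFinset, Metric.ball (mixedEmbedding K a) (1 / 2)) ⊆
      Metric.ball 0 (r + 1 / 2) := by
    refine Set.iUnion₂_subset fun a ha => Metric.ball_subset_ball' ?_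
    have : ‖mixedEmbedding K a‖ ≤ r := by simpa [B] using ha
    rw [dist_zero_right]
    linarith
  have h := measure_mono (μ := volume) hsub
  rw [measure_biUnion_finset hdisj fun _ _ => Metric.isOpen_ball.measurableSet] at h
  simp only [mixedEmbedding.volume_ball_of_isTotallyReal _ (one_half_pos (α := ℝ)),
    mixedEmbedding.volume_ball_of_isTotallyReal _ (show 0 < r + 1 / 2 by linarith)] at h
  norm_num at h
  rw [Set.ncard_eq_toFinset_card _ hfin]
  rw [← ENNReal.ofReal_natCast, ENNReal.ofReal_le_ofReal_iff (by positivity)] at h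
  convert h using 2
  ring

open scoped Classical in
/-- Averaging over translates of a box of side `r` by a fundamental domain. -/
theorem RingOfIntegers.le_ncard_setOf_norm_mixedEmbedding_le [IsTotallyReal K] {r : ℝ}
    (hr : 0 < r) :
    r ^ finrank ℚ K / √(discr K).natAbs ≤ ({a : 𝓞 K | ‖mixedEmbedding K a‖ ≤ r}.ncard : ℝ) := by
  classical
  have hfin := finite_setOf_norm_mixedEmbedding_le (K := K) r
  set B := {a : 𝓞 K | ‖mixedEmbedding K a‖ ≤ r}
  have : VAddInvariantMeasure (mixedEmbedding.integerLattice K) (mixedEmbedding.mixedSpace K)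
      volume :=
    inferInstanceAs <| VAddInvariantMeasure (mixedEmbedding.integerLattice K).toAddSubgroup
      (mixedEmbedding.mixedSpace K) volume
  have key := (mixedEmbedding.fundamentalDomain_integerLattice K).measure_le_mul_of_ncard_le
    (s := Metric.ball 0 (r / 2)) Metric.isOpen_ball.measurableSet B.ncard fun x => by
      set T := {g : mixedEmbedding.integerLattice K | g +ᵥ x ∈ Metric.ball 0 (r / 2)}
      obtain hT | ⟨g₀, hg₀⟩ := T.eq_empty_or_nonempty
      · simp [hT]
      let f : 𝓞 K → mixedEmbedding.integerLattice K := fun a => ⟨mixedEmbedding K a, a, rfl⟩ + g₀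
      have hsub : T ⊆ f '' B := by
        intro g hg
        obtain ⟨a, ha⟩ := (g - g₀).2
        have ha : mixedEmbedding K a = (g : mixedEmbedding.mixedSpace K) - g₀ := ha
        refine ⟨a, ?_, Subtype.ext (by simp [f, ha])⟩
        have h₁ : ‖(g : mixedEmbedding.mixedSpace K) + x‖ < r / 2 := by
          simpa [T, Submodule.vadd_def] using hg
        have h₂ : ‖(g₀ : mixedEmbedding.mixedSpace K) + x‖ < r / 2 := by
          simpa [T, Submodule.vadd_def] using hg₀
        have h₃ := norm_sub_le ((g : mixedEmbedding.mixedSpace K) + x) (g₀ + x)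
        rw [add_sub_add_right_eq_sub, ← ha] at h₃
        show _ ≤ r
        linarith
      have hfin' := hfin.image f
      exact ⟨hfin'.subset hsub, (Set.ncard_le_ncard hsub hfin').trans (Set.ncard_image_le hfin)⟩
  rw [mixedEmbedding.volume_ball_of_isTotallyReal _ (half_pos hr),
    mixedEmbedding.volume_fundamentalDomain_latticeBasis,
    IsTotallyReal.nrComplexPlaces_eq_zero] at key
  have hsqrt : (NNReal.sqrt ‖discr K‖₊ : ℝ) = √(discr K).natAbs := by
    simp [Real.coe_sqrt, Int.norm_eq_abs]
  have hpos : 0 < √((discr K).natAbs : ℝ) :=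
    Real.sqrt_pos.mpr (by exact_mod_cast Int.natAbs_pos.mpr (discr_ne_zero K))
  rw [pow_zero, one_mul, mul_div_cancel₀ _ two_ne_zero, ← ENNReal.ofReal_natCast,
    ← ENNReal.ofReal_coe_nnreal, ← ENNReal.ofReal_mul (by positivity),
    ENNReal.ofReal_le_ofReal_iff (by positivity), hsqrt] at key
  rwa [div_le_iff₀ hpos]

end NumberField

/-- Let `K` be a totally real number field of degree `d`. For any `X ≥ 1` the box
`B⁺(X) = {α ∈ 𝓞 K : |σ(α)| ≤ X for all embeddings σ : K → ℝ}` is finite and satisfies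
`X^d Δ_K^{-1/2} ≤ |B⁺(X)| ≤ (2X+1)^d`. -/
theorem statement12 (K : Type*) [Field K] [NumberField K]
    (htr : TotallyReal K) (d : ℕ) (hd : Module.finrank ℚ K = d)
    (X : ℝ) (hX : 1 ≤ X) :
    {α : 𝓞 K | ∀ σ : K →+* ℝ, |σ (algebraMap (𝓞 K) K α)| ≤ X}.Finite ∧
    X ^ d / Real.sqrt ((NumberField.discr K).natAbs) ≤
      ({α : 𝓞 K | ∀ σ : K →+* ℝ, |σ (algebraMap (𝓞 K) K α)| ≤ X}.ncard : ℝ) ∧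
    ({α : 𝓞 K | ∀ σ : K →+* ℝ, |σ (algebraMap (𝓞 K) K α)| ≤ X}.ncard : ℝ) ≤
      (2 * X + 1) ^ d := by
  subst hd
  have := NumberField.TotallyReal.isTotallyReal htr
  simp only [← forall_infinitePlace_le_iff_forall_real, ← mixedEmbedding.norm_le_iff]
  exact ⟨RingOfIntegers.finite_setOf_norm_mixedEmbedding_le X,
    RingOfIntegers.le_ncard_setOf_norm_mixedEmbedding_le (by linarith),
    RingOfIntegers.ncard_setOf_norm_mixedEmbedding_le (by linarith)⟩
end

section
/- Let K be a totally real number field and let φ = (1+√5)/2. If u ∈ O_K^× is a unit such that φ^{−1} < |σ(u)| < φ for every embedding σ : K → ℝ, then u = 1 or u = −1. -/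
open NumberField

/-- A real number whose absolute value lies strictly between `φ⁻¹` and `φ`, where `φ` is the
golden ratio, differs from its inverse by less than `1`. -/
theorem abs_sub_inv_lt_one {x : ℝ} (h₁ : Real.goldenRatio⁻¹ < |x|) (h₂ : |x| < Real.goldenRatio) :
    |x - x⁻¹| < 1 := by
  have hpos : 0 < |x| := (inv_pos.2 Real.goldenRatio_pos).trans h₁
  have hinv : Real.goldenRatio⁻¹ = Real.goldenRatio - 1 := by
    rw [Real.inv_goldenRatio, ← Real.one_sub_goldenRatio]
    ring
  have h₃ : |x|⁻¹ < Real.goldenRatio := inv_lt_of_inv_lt₀ Real.goldenRatio_pos h₁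
  have h₄ : Real.goldenRatio⁻¹ < |x|⁻¹ := (inv_lt_inv₀ Real.goldenRatio_pos hpos).2 h₂
  rw [hinv] at h₁ h₄
  rcases abs_cases x with ⟨h, _⟩ | ⟨h, _⟩
  · rw [h] at h₁ h₂ h₃ h₄
    rw [abs_lt]
    constructor <;> linarith
  · rw [h, inv_neg] at h₃ h₄
    rw [h] at h₁ h₂
    rw [abs_lt]
    constructor <;> linarith

/-- An algebraic integer with absolute value less than `1` at every infinite place is zero. -/
theorem NumberField.RingOfIntegers.eq_zero_of_forall_infinitePlace_lt_one
    {K : Type*} [Field K] [NumberField K] {x : 𝓞 K}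
    (h : ∀ w : InfinitePlace K, w x < 1) : x = 0 := by
  by_contra hx
  obtain ⟨w⟩ := (inferInstance : Nonempty (InfinitePlace K))
  exact (h w).not_ge (InfinitePlace.one_le_of_lt_one hx fun z _ ↦ h z)

/-- Let `K` be totally real and `φ = (1+√5)/2`. If `u ∈ 𝓞_K^×` satisfies
`φ⁻¹ < |σ(u)| < φ` for every embedding `σ : K → ℝ`, then `u = ±1`. -/
theorem statement13 (K : Type*) [Field K] [NumberField K]
    (htr : TotallyReal K) (u : (𝓞 K)ˣ)
    (hu : ∀ σ : K →+* ℝ,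
      ((1 + Real.sqrt 5) / 2)⁻¹ < |σ (algebraMap (𝓞 K) K (u : 𝓞 K))| ∧
      |σ (algebraMap (𝓞 K) K (u : 𝓞 K))| < (1 + Real.sqrt 5) / 2) :
    u = 1 ∨ u = -1 := by
  have hzero : (u : 𝓞 K) - ((u⁻¹ : (𝓞 K)ˣ) : 𝓞 K) = 0 := by
    refine RingOfIntegers.eq_zero_of_forall_infinitePlace_lt_one fun w ↦ ?_
    have hw : ComplexEmbedding.IsReal w.embedding :=
      RingHom.ext fun x ↦ Complex.conj_eq_iff_im.2 (htr w.embedding x)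
    have hlt := abs_sub_inv_lt_one (hu hw.embedding).1 (hu hw.embedding).2
    rw [← InfinitePlace.norm_embedding_eq, ← hw.coe_embedding_apply, Complex.norm_real,
      Real.norm_eq_abs]
    have hinv : algebraMap (𝓞 K) K ((u⁻¹ : (𝓞 K)ˣ) : 𝓞 K) =
        (algebraMap (𝓞 K) K (u : 𝓞 K))⁻¹ := by
      refine eq_inv_of_mul_eq_one_left ?_
      rw [← map_mul, Units.inv_mul, map_one]
    change |hw.embedding (algebraMap (𝓞 K) K _)| < 1
    rwa [map_sub, hinv, map_sub, map_inv₀]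
  have hself : u = u⁻¹ := Units.ext (sub_eq_zero.1 hzero)
  have hsq : (u : 𝓞 K) * u = 1 := by
    rw [← Units.val_mul, mul_eq_one_iff_eq_inv.2 hself, Units.val_one]
  rcases mul_self_eq_one_iff.1 hsq with h | h
  · exact Or.inl (Units.ext h)
  · exact Or.inr (Units.ext h)
end

section
/- There exists an absolute constant c > 0 such that the following holds: for every totally real number field K of degree d ≥ 2 over ℚ with discriminant Δ_K, and every real Y ≥ 2, there exists a finite set A ⊆ O_K such that (cY)^d/(Y·Δ_K^{3/2}) ≤ |A| ≤ (Y/c)^d and, for every integer k ≥ 2, max(|kA|, |A^{(k)}|) ≤ (k·e^Y/c)^d. -/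
open Pointwise NumberField

/-- The `k`-fold sum set `kA = {a₁ + ⋯ + a_k : aᵢ ∈ A}`. -/
def kfoldSumSet {R : Type*} [AddCommMonoid R] (k : ℕ) (A : Set R) : Set R :=
  {x | ∃ f : Fin k → R, (∀ i, f i ∈ A) ∧ ∑ i, f i = x}

/-- The `k`-fold product set `A^{(k)} = {a₁ ⋯ a_k : aᵢ ∈ A}`. -/
def kfoldProdSet {R : Type*} [CommMonoid R] (k : ℕ) (A : Set R) : Set R :=
  {x | ∃ f : Fin k → R, (∀ i, f i ∈ A) ∧ ∏ i, f i = x}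

theorem card_le_mul_pow_of_one_le_mul_prod {ι : Type*} [Fintype ι] (S : Finset (ι → ℕ))
    {h : ℕ → ℝ} (h0 : ∀ m, 0 ≤ h m) {C : ℝ} (hC : ∀ F : Finset ℕ, ∑ m ∈ F, h m ≤ C)
    {X : ℝ} (hX : 0 ≤ X) (hS : ∀ n ∈ S, 1 ≤ X * ∏ i, h (n i)) :
    (S.card : ℝ) ≤ X * C ^ Fintype.card ι := by
  classical
  have hsub : S ⊆ Fintype.piFinset fun i => S.image fun n => n i := fun n hn =>
    Fintype.mem_piFinset.2 fun i => Finset.mem_image_of_mem (fun n : ι → ℕ => n i) hn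
  calc (S.card : ℝ) = ∑ n ∈ S, (1 : ℝ) := by simp
    _ ≤ ∑ n ∈ S, X * ∏ i, h (n i) := Finset.sum_le_sum hS
    _ ≤ ∑ n ∈ Fintype.piFinset fun i => S.image fun n => n i, X * ∏ i, h (n i) :=
        Finset.sum_le_sum_of_subset_of_nonneg hsub fun n _ _ =>
          mul_nonneg hX (Finset.prod_nonneg fun i _ => h0 _)
    _ = X * ∏ i, ∑ m ∈ S.image fun n => n i, h m := by
        rw [← Finset.mul_sum, Finset.prod_univ_sum]
    _ ≤ X * ∏ _i : ι, C := by
        gcongr with i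
        · exact fun i _ => Finset.sum_nonneg fun m _ => h0 m
        · exact hC _
    _ = X * C ^ Fintype.card ι := by simp

theorem sum_inv_sq_le_two (F : Finset ℕ) : ∑ m ∈ F, ((m : ℝ) ^ 2)⁻¹ ≤ 2 := by
  have h := hasSum_zeta_two
  simp only [one_div] at h
  refine (sum_le_hasSum F (fun _ _ => by positivity) h).trans ?_
  nlinarith [Real.pi_lt_d2, Real.pi_pos]

theorem sum_inv_two_pow_le_two (F : Finset ℕ) : ∑ m ∈ F, ((2 : ℝ)⁻¹) ^ m ≤ 2 := by
  have h := hasSum_geometric_two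
  simp only [one_div] at h
  exact sum_le_hasSum F (fun _ _ => by positivity) h

theorem exists_prime_index (K : Type*) [Field K] [NumberField K] :
    ∃ (p : Ideal (𝓞 K) → ℕ) (j : Ideal (𝓞 K) → Fin (Module.finrank ℚ K)),
      (∀ P : Ideal (𝓞 K), P.IsPrime → P ≠ ⊥ → (p P).Prime ∧ p P ≤ Ideal.absNorm P) ∧
      ∀ P Q : Ideal (𝓞 K), P.IsPrime → P ≠ ⊥ → Q.IsPrime → Q ≠ ⊥ →
        p P = p Q → j P = j Q → P = Q := by
  classical
  have hex : ∀ P : Ideal (𝓞 K), ∃ q : ℕ, P.IsPrime → P ≠ ⊥ →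
      q.Prime ∧ q ≤ Ideal.absNorm P ∧ (q : 𝓞 K) ∈ P := by
    intro P
    by_cases hP : P.IsPrime ∧ P ≠ ⊥
    swap
    · exact ⟨0, fun h1 h2 => absurd ⟨h1, h2⟩ hP⟩
    have h0 : Ideal.absNorm P ≠ 0 := Ideal.absNorm_eq_zero_iff.not.2 hP.2
    have hmem := Ideal.absNorm_mem P
    rw [← Nat.prod_primeFactorsList h0, Nat.cast_list_prod, ← Multiset.prod_coe,
      hP.1.multiset_prod_mem_iff_exists_mem] at hmem
    obtain ⟨x, hx, hxP⟩ := hmem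
    obtain ⟨q, hq, rfl⟩ := List.mem_map.1 (Multiset.mem_coe.1 hx)
    exact ⟨q, fun _ _ => ⟨Nat.prime_of_mem_primeFactorsList hq,
      Nat.le_of_dvd (Nat.pos_of_ne_zero h0) (Nat.dvd_of_mem_primeFactorsList hq), hxP⟩⟩
  choose p hp using hex
  have hcard : ∀ (q : ℕ) (s : Finset (Ideal (𝓞 K))),
      (∀ P ∈ s, (P.IsPrime ∧ P ≠ ⊥) ∧ p P = q) → s.card ≤ Module.finrank ℚ K := by
    intro q s hs
    rcases s.eq_empty_or_nonempty with rfl | ⟨P₀, hP₀⟩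
    · simp
    have hq : q.Prime := by
      rw [← (hs P₀ hP₀).2]
      exact (hp P₀ (hs P₀ hP₀).1.1 (hs P₀ hP₀).1.2).1
    have hdvd : ∏ P ∈ s, P ∣ Ideal.span {(q : 𝓞 K)} := by
      refine Finset.prod_primes_dvd _ (fun P hP => ?_) fun P hP => ?_
      · exact Ideal.prime_of_isPrime (hs P hP).1.2 (hs P hP).1.1
      · rw [Ideal.dvd_span_singleton, ← (hs P hP).2]
        exact (hp P (hs P hP).1.1 (hs P hP).1.2).2.2
    have hle := Nat.le_of_dvd (Nat.pos_of_ne_zero ?_) (map_dvd Ideal.absNorm hdvd)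
    · rw [map_prod, Ideal.absNorm_span_natCast, RingOfIntegers.rank] at hle
      refine (Nat.pow_le_pow_iff_right hq.one_lt).1 (le_trans ?_ hle)
      rw [← Finset.prod_const]
      refine Finset.prod_le_prod' fun P hP => ?_
      rw [← (hs P hP).2]
      exact (hp P (hs P hP).1.1 (hs P hP).1.2).2.1
    · rw [Ideal.absNorm_span_natCast]
      exact pow_ne_zero _ hq.ne_zero
  have hinj : ∀ q : ℕ, ∃ e : Ideal (𝓞 K) → Fin (Module.finrank ℚ K),
      Set.InjOn e {P | (P.IsPrime ∧ P ≠ ⊥) ∧ p P = q} := by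
    intro q
    have : Nonempty (Fin (Module.finrank ℚ K)) := ⟨⟨0, Module.finrank_pos⟩⟩
    have hfin : {P : Ideal (𝓞 K) | (P.IsPrime ∧ P ≠ ⊥) ∧ p P = q}.Finite := by
      by_contra hinf
      obtain ⟨s, hs, hsc⟩ := Set.Infinite.exists_subset_card_eq hinf (Module.finrank ℚ K + 1)
      have := hcard q s fun P hP => hs hP
      lia
    obtain ⟨e⟩ : Nonempty (hfin.toFinset ↪ Fin (Module.finrank ℚ K)) :=
      Function.Embedding.nonempty_of_card_le (by
        rw [Fintype.card_coe, Fintype.card_fin]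
        exact hcard q _ fun P hP => hfin.mem_toFinset.1 hP)
    refine ⟨fun P => if h : P ∈ hfin.toFinset then e ⟨P, h⟩ else Classical.arbitrary _,
      fun P hP Q hQ h => ?_⟩
    simp only [dif_pos (hfin.mem_toFinset.2 hP), dif_pos (hfin.mem_toFinset.2 hQ)] at h
    exact Subtype.ext_iff.1 (e.injective h)
  choose e he using hinj
  refine ⟨p, fun P => e (p P) P, fun P h1 h2 => ⟨(hp P h1 h2).1, (hp P h1 h2).2.1⟩,
    fun P Q hP hP0 hQ hQ0 hpq h => he (p P) ⟨⟨hP, hP0⟩, rfl⟩ ⟨⟨hQ, hQ0⟩, hpq.symm⟩ ?_⟩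
  simpa only [hpq] using h

theorem exists_tuple_of_ideal (K : Type*) [Field K] [NumberField K] :
    ∃ F : Ideal (𝓞 K) → Fin (Module.finrank ℚ K) → ℕ,
      (∀ I, I ≠ ⊥ → (∀ j, 0 < F I j) ∧ ∏ j, F I j ≤ Ideal.absNorm I) ∧
      Set.InjOn F {I | I ≠ ⊥} := by
  classical
  obtain ⟨p, j, hp, hinj⟩ := exists_prime_index K
  let f := fun I : Ideal (𝓞 K) => UniqueFactorizationMonoid.normalizedFactors I
  have hf : ∀ I, ∀ P ∈ f I, P.IsPrime ∧ P ≠ ⊥ := fun I P hP => by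
    have := UniqueFactorizationMonoid.prime_of_normalized_factor P hP
    exact ⟨Ideal.isPrime_of_prime this, this.ne_zero⟩
  let M := fun (I : Ideal (𝓞 K)) i => ((f I).filter (fun P => j P = i)).map p
  have hM : ∀ I i, ∀ q ∈ M I i, q.Prime := fun I i q hq => by
    obtain ⟨P, hP, rfl⟩ := Multiset.mem_map.1 hq
    have := hf I P (Multiset.mem_filter.1 hP).1
    exact (hp P this.1 this.2).1
  refine ⟨fun I i => (M I i).prod, fun I hI => ⟨fun i => ?_, ?_⟩, fun I hI J hJ h => ?_⟩
  · exact Nat.pos_of_ne_zero (Multiset.prod_ne_zero fun h => (hM I i 0 h).ne_zero rfl)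
  · have h1 : ∏ i, (M I i).prod = ((f I).map p).prod := by
      simp only [M]
      generalize f I = s
      induction s using Multiset.induction_on with
      | empty => simp
      | cons P s ih =>
        have : ∀ i, (((P ::ₘ s).filter (fun P => j P = i)).map p).prod =
            (if j P = i then p P else 1) * ((s.filter (fun P => j P = i)).map p).prod := by
          intro i
          by_cases h : j P = i <;> simp [h]
        simp_rw [this]
        rw [Finset.prod_mul_distrib, ih]
        simp
    have h2 : Ideal.absNorm I = ((f I).map Ideal.absNorm).prod := by
      conv_lhs => rw [← associated_iff_eq.1 (UniqueFactorizationMonoid.prod_normalizedFactors hI)]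
      exact map_multiset_prod _ _
    rw [h1, h2]
    exact Multiset.prod_map_le_prod_map _ _ fun P hP => (hp P (hf I P hP).1 (hf I P hP).2).2
  · have hM' : ∀ i, M I i = M J i := fun i => by
      have := congrFun h i
      simp only at this
      rw [← UniqueFactorizationMonoid.normalizedFactors_prod_of_prime fun q hq =>
          (hM I i q hq).prime, this,
        UniqueFactorizationMonoid.normalizedFactors_prod_of_prime fun q hq => (hM J i q hq).prime]
    have hff : f I = f J := by
      ext P
      by_cases hP : P.IsPrime ∧ P ≠ ⊥
      · have : ∀ L, (M L (j P)).count (p P) = (f L).count P := fun L => by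
          rw [Multiset.count_map, Multiset.filter_filter, Multiset.count_eq_card_filter_eq]
          refine congrArg _ (Multiset.filter_congr fun Q hQ => ⟨fun h => ?_, ?_⟩)
          · exact hinj P Q hP.1 hP.2 (hf L Q hQ).1 (hf L Q hQ).2 h.1 h.2.symm
          · rintro rfl
            exact ⟨rfl, rfl⟩
        rw [← this, ← this, hM']
      · rw [Multiset.count_eq_zero_of_notMem fun h => hP (hf I P h),
          Multiset.count_eq_zero_of_notMem fun h => hP (hf J P h)]
    rw [← associated_iff_eq.1 (UniqueFactorizationMonoid.prod_normalizedFactors hI),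
      ← associated_iff_eq.1 (UniqueFactorizationMonoid.prod_normalizedFactors hJ)]
    exact congrArg _ hff

theorem card_ideals_le (K : Type*) [Field K] [NumberField K] (S : Finset (Ideal (𝓞 K))) {X : ℝ}
    (hS : ∀ I ∈ S, I ≠ ⊥ ∧ (Ideal.absNorm I : ℝ) ≤ X) :
    (S.card : ℝ) ≤ X ^ 2 * 2 ^ Module.finrank ℚ K := by
  classical
  obtain ⟨F, hF, hinj⟩ := exists_tuple_of_ideal K
  rw [← Finset.card_image_of_injOn (hinj.mono fun I hI => (hS I hI).1)]
  have := card_le_mul_pow_of_one_le_mul_prod (S.image F) (h := fun m => ((m : ℝ) ^ 2)⁻¹)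
    (fun m => by positivity) sum_inv_sq_le_two (sq_nonneg X) ?_
  · simpa using this
  · intro n hn
    obtain ⟨I, hI, rfl⟩ := Finset.mem_image.1 hn
    obtain ⟨hpos, hle⟩ := hF I (hS I hI).1
    have hpos' : (0 : ℝ) < ∏ i, (F I i : ℝ) :=
      Finset.prod_pos fun i _ => Nat.cast_pos.2 (hpos i)
    have hle' : ∏ i, (F I i : ℝ) ≤ X := by
      refine le_trans ?_ (hS I hI).2
      exact_mod_cast hle
    rw [Finset.prod_inv_distrib, Finset.prod_pow, ← div_eq_mul_inv, one_le_div (by positivity)]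
    gcongr

/-- The real embedding attached to an infinite place of a totally real field. -/
noncomputable def realEmb {K : Type*} [Field K] [IsTotallyReal K] (w : InfinitePlace K) :
    K →+* ℝ :=
  InfinitePlace.embedding_of_isReal (IsTotallyReal.isReal w)

theorem abs_realEmb {K : Type*} [Field K] [IsTotallyReal K] (w : InfinitePlace K) (x : K) :
    |realEmb w x| = w x :=
  InfinitePlace.norm_embedding_of_isReal _ x

theorem infinitePlace_pos {K : Type*} [Field K] (w : InfinitePlace K) {x : 𝓞 K} (hx : x ≠ 0) :
    0 < w (x : K) :=
  InfinitePlace.pos_iff.2 (RingOfIntegers.coe_ne_zero_iff.2 hx)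

section
variable {K : Type*} [Field K] [NumberField K] [IsTotallyReal K]

theorem prod_infinitePlace_eq (x : 𝓞 K) :
    ∏ w : InfinitePlace K, w (x : K) = Ideal.absNorm (Ideal.span {x}) := by
  have h := InfinitePlace.prod_eq_abs_norm (x : K)
  simp only [IsTotallyReal.mult_eq, pow_one] at h
  rw [h, Ideal.absNorm_span_singleton, ← Algebra.coe_norm_int, Nat.cast_natAbs]
  simp

theorem one_le_prod_infinitePlace {x : 𝓞 K} (hx : x ≠ 0) :
    1 ≤ ∏ w : InfinitePlace K, w (x : K) := by
  rw [prod_infinitePlace_eq, Nat.one_le_cast, Nat.one_le_iff_ne_zero, Ne,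
    Ideal.absNorm_eq_zero_iff, Ideal.span_singleton_eq_bot]
  exact hx

theorem prod_infinitePlace_of_isUnit {x : 𝓞 K} (hx : IsUnit x) :
    ∏ w : InfinitePlace K, w (x : K) = 1 := by
  rw [prod_infinitePlace_eq, Ideal.span_singleton_eq_top.2 hx, Ideal.absNorm_top, Nat.cast_one]

theorem card_infinitePlace_eq : Fintype.card (InfinitePlace K) = Module.finrank ℚ K := by
  rw [InfinitePlace.card_eq_nrRealPlaces_add_nrComplexPlaces, IsTotallyReal.finrank K,
    IsTotallyReal.nrComplexPlaces_eq_zero, add_zero]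

/-- Two integers whose difference is smaller than a unit at every infinite place are equal. -/
theorem eq_of_forall_infinitePlace_sub_lt {x y u : 𝓞 K} (hu : IsUnit u)
    (h : ∀ w : InfinitePlace K, w ((x : K) - y) < w (u : K)) : x = y := by
  by_contra hne
  have h1 := one_le_prod_infinitePlace (sub_ne_zero.2 hne)
  rw [← prod_infinitePlace_of_isUnit hu] at h1
  refine absurd h1 (not_le.2 ?_)
  refine Finset.prod_lt_prod_of_nonempty (fun w _ => infinitePlace_pos w (sub_ne_zero.2 hne))
    (fun w _ => ?_) Finset.univ_nonempty
  simpa using h w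

theorem card_Icc_floor_le {T : ℝ} (hT : 1 ≤ T) :
    ((Finset.Icc ⌊-T⌋ ⌊T⌋).card : ℝ) ≤ 4 * T := by
  have h1 : ⌊-T⌋ ≤ ⌊T⌋ + 1 := (Int.floor_mono (by linarith)).trans (by lia)
  rw [Int.card_Icc]
  have : (((⌊T⌋ + 1 - ⌊-T⌋).toNat : ℤ) : ℝ) = ((⌊T⌋ + 1 - ⌊-T⌋ : ℤ) : ℝ) := by
    rw [Int.toNat_of_nonneg (by lia)]
  rw [Int.cast_natCast] at this
  rw [this]
  push_cast
  linarith [Int.floor_le T, Int.lt_floor_add_one (-T)]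

theorem Set.ncard_le_pow_of_floor_injOn {α ι β : Type*} [Fintype ι] [Fintype β] {S : Set α}
    (g : α → ι → ℝ) (s : α → ι → β) {T : ℝ} (hT : 1 ≤ T) (hg : ∀ x ∈ S, ∀ i, |g x i| ≤ T)
    (hinj : ∀ x ∈ S, ∀ y ∈ S, (∀ i, ⌊g x i⌋ = ⌊g y i⌋ ∧ s x i = s y i) → x = y) :
    S.Finite ∧ (S.ncard : ℝ) ≤ (4 * T * Fintype.card β) ^ Fintype.card ι := by
  classical
  let F : α → ι → ℤ × β := fun x i => (⌊g x i⌋, s x i)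
  have hF : Set.InjOn F S := fun x hx y hy h => hinj x hx y hy fun i =>
    Prod.ext_iff.1 (congrFun h i)
  let B : Finset (ι → ℤ × β) := Fintype.piFinset fun _ => Finset.Icc ⌊-T⌋ ⌊T⌋ ×ˢ Finset.univ
  have hmaps : Set.MapsTo F S B := fun x hx => by
    simp only [B, F, Finset.mem_coe, Fintype.mem_piFinset, Finset.mem_product, Finset.mem_Icc,
      Finset.mem_univ, and_true]
    exact fun i => ⟨Int.floor_mono (abs_le.1 (hg x hx i)).1,
      Int.floor_mono (abs_le.1 (hg x hx i)).2⟩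
  refine ⟨Set.Finite.of_injOn hmaps hF B.finite_toSet, ?_⟩
  have h := Set.ncard_le_ncard_of_injOn F hmaps hF B.finite_toSet
  rw [Set.ncard_coe_finset] at h
  calc (S.ncard : ℝ) ≤ B.card := Nat.cast_le.2 h
    _ = ((Finset.Icc ⌊-T⌋ ⌊T⌋).card * Fintype.card β : ℝ) ^ Fintype.card ι := by
        simp only [B, Fintype.card_piFinset, Finset.card_product, Finset.prod_const,
          Finset.card_univ]
        push_cast
        rfl
    _ ≤ _ := by gcongr; exact card_Icc_floor_le hT

theorem ncard_integers_le {S : Set (𝓞 K)} {T : ℝ} (hT : 1 ≤ T)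
    (hS : ∀ x ∈ S, ∀ w : InfinitePlace K, w (x : K) ≤ T) :
    S.Finite ∧ (S.ncard : ℝ) ≤ (4 * T) ^ Module.finrank ℚ K := by
  have h := Set.ncard_le_pow_of_floor_injOn (S := S) (β := Unit)
    (fun x (w : InfinitePlace K) => realEmb w (x : K)) (fun _ _ => ()) hT
    (fun x hx w => by rw [abs_realEmb]; exact hS x hx w) ?_
  · simpa [card_infinitePlace_eq] using h
  · intro x _ y _ h
    refine eq_of_forall_infinitePlace_sub_lt isUnit_one fun w => ?_
    rw [← abs_realEmb, map_sub]
    simpa using Int.abs_sub_lt_one_of_floor_eq_floor (h w).1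

theorem abs_sub_lt_of_floor_two_mul_log {a b : ℝ} (ha : a ≠ 0) (hb : b ≠ 0)
    (hs : 0 < a ↔ 0 < b)
    (h : ⌊2 * Real.log |a|⌋ = ⌊2 * Real.log |b|⌋) : |a - b| < |b| := by
  have h1 := abs_lt.1 (Int.abs_sub_lt_one_of_floor_eq_floor h)
  have ha' := abs_pos.2 ha
  have hb' := abs_pos.2 hb
  have hlt : |a| < 2 * |b| := by
    rw [← Real.log_lt_log_iff ha' (by positivity), Real.log_mul (by norm_num) hb'.ne']
    linarith [Real.log_two_gt_d9]
  rcases lt_or_gt_of_ne hb with hb0 | hb0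
  · have ha0 : a < 0 := lt_of_le_of_ne (not_lt.1 fun h => hb0.not_gt (hs.1 h)) ha
    rw [abs_of_neg ha0, abs_of_neg hb0] at hlt
    rw [abs_of_neg hb0, abs_lt]
    constructor <;> linarith
  · have ha0 := hs.2 hb0
    rw [abs_of_pos ha0, abs_of_pos hb0] at hlt
    rw [abs_of_pos hb0, abs_lt]
    constructor <;> linarith

theorem ncard_units_le {S : Set (𝓞 K)} {T : ℝ} (hT : 1 ≤ T) (hunit : ∀ x ∈ S, IsUnit x)
    (hS : ∀ x ∈ S, ∀ w : InfinitePlace K, |Real.log (w (x : K))| ≤ T) :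
    S.Finite ∧ (S.ncard : ℝ) ≤ (16 * T) ^ Module.finrank ℚ K := by
  have h := Set.ncard_le_pow_of_floor_injOn (S := S) (T := 2 * T)
    (fun x (w : InfinitePlace K) => 2 * Real.log (w (x : K)))
    (fun x w => 0 < realEmb w (x : K)) (by linarith)
    (fun x hx w => by rw [abs_mul, abs_two]; linarith [hS x hx w]) ?_
  · rw [card_infinitePlace_eq, Fintype.card_prop] at h
    convert h using 3
    push_cast
    ring
  · intro x hx y hy h
    refine eq_of_forall_infinitePlace_sub_lt (hunit y hy) fun w => ?_
    rw [← abs_realEmb, ← abs_realEmb, map_sub]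
    have hne : ∀ z ∈ S, realEmb w (z : K) ≠ 0 := fun z hz =>
      (map_ne_zero _).2 (RingOfIntegers.coe_ne_zero_iff.2 (hunit z hz).ne_zero)
    refine abs_sub_lt_of_floor_two_mul_log (hne x hx) (hne y hy) (iff_of_eq (h w).2) ?_
    rw [abs_realEmb, abs_realEmb]
    exact (h w).1

open mixedEmbedding MeasureTheory in
theorem exists_ne_zero_infinitePlace_lt {f : InfinitePlace K → ℝ} (hf : ∀ w, 0 < f w)
    (hprod : √|(discr K : ℝ)| < ∏ w, f w) :
    ∃ a : 𝓞 K, a ≠ 0 ∧ ∀ w : InfinitePlace K, w (a : K) < f w := by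
  classical
  let g : InfinitePlace K → NNReal := fun w => ⟨f w, (hf w).le⟩
  suffices h : minkowskiBound K ↑1 < volume (convexBodyLT K g) from
    exists_ne_zero_mem_ringOfIntegers_lt K h
  rw [convexBodyLT_volume, minkowskiBound, volume_fundamentalDomain_fractionalIdealLatticeBasis,
    volume_fundamentalDomain_latticeBasis, mixedEmbedding.finrank, convexBodyLTFactor]
  have h1 : (NNReal.sqrt ‖discr K‖₊ : NNReal) < ∏ w, g w := by
    rw [← NNReal.coe_lt_coe, NNReal.coe_prod, Real.coe_sqrt, coe_nnnorm, Int.norm_eq_abs]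
    exact hprod
  have h2 := mul_lt_mul_of_pos_right h1 (show (0 : NNReal) < 2 ^ InfinitePlace.nrRealPlaces K by
    positivity)
  rw [mul_comm (∏ w, g w)] at h2
  simpa [IsTotallyReal.finrank] using ENNReal.coe_lt_coe.2 h2

/-- The units of `𝓞 K` all of whose logarithmic embeddings are bounded by `Y`. -/
def boundedUnits (K : Type*) [Field K] (Y : ℝ) : Set (𝓞 K) :=
  {u | IsUnit u ∧ ∀ w : InfinitePlace K, |Real.log (w (u : K))| ≤ Y}

theorem exists_minkowski_point {N : ℝ} (hN : √|(discr K : ℝ)| < N) (t : InfinitePlace K → ℕ) :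
    ∃ x : 𝓞 K, x ≠ 0 ∧ ∀ w : InfinitePlace K, Real.log (w (x : K)) <
      t w + (Real.log N - (∑ v, t v : ℕ)) / Module.finrank ℚ K := by
  have hN0 : 0 < N := (Real.sqrt_nonneg _).trans_lt hN
  have hd : (Module.finrank ℚ K : ℝ) ≠ 0 := Nat.cast_ne_zero.2 Module.finrank_pos.ne'
  obtain ⟨x, hx, h⟩ := exists_ne_zero_infinitePlace_lt (K := K)
    (f := fun w => Real.exp (t w + (Real.log N - (∑ v, t v : ℕ)) / Module.finrank ℚ K))
    (fun w => Real.exp_pos _) (by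
      rw [← Real.exp_sum, Finset.sum_add_distrib, Finset.sum_const, Finset.card_univ,
        card_infinitePlace_eq, nsmul_eq_mul, mul_div_cancel₀ _ hd, Nat.cast_sum,
        add_sub_cancel, Real.exp_log hN0]
      exact hN)
  exact ⟨x, hx, fun w => (Real.log_lt_iff_lt_exp (infinitePlace_pos w hx)).2 (h w)⟩

set_option maxHeartbeats 1000000 in
theorem pow_floor_le_ncard_boundedUnits {N Y : ℝ} (hN : √|(discr K : ℝ)| < N) (hY : 1 ≤ Y) :
    (⌊Y⌋₊ : ℝ) ^ Module.finrank ℚ K ≤ (boundedUnits K Y).ncard *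
      ((Module.finrank ℚ K * (⌊Y⌋₊ - 1) + 1) * (N ^ 2 * 2 ^ Module.finrank ℚ K) *
        (N * 2 ^ Module.finrank ℚ K)) := by
  classical
  have hN0 : 0 < N := (Real.sqrt_nonneg _).trans_lt hN
  have hd : (Module.finrank ℚ K : ℝ) ≠ 0 := Nat.cast_ne_zero.2 Module.finrank_pos.ne'
  have hm : 1 ≤ ⌊Y⌋₊ := (Nat.one_le_floor_iff _).2 hY
  have hfin : (boundedUnits K Y).Finite :=
    (ncard_units_le hY (fun x hx => hx.1) fun x hx => hx.2).1
  choose x hx0 hx using exists_minkowski_point (K := K) hN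
  let T : Finset (InfinitePlace K → ℕ) := Fintype.piFinset fun _ => Finset.range ⌊Y⌋₊
  have hT : ∀ t ∈ T, ∀ w, t w + 1 ≤ ⌊Y⌋₊ := fun t ht w =>
    Finset.mem_range.1 (Fintype.mem_piFinset.1 ht w)
  let g : (InfinitePlace K → ℕ) → InfinitePlace K → ℝ := fun t w =>
    t w + (Real.log N - (∑ v, t v : ℕ)) / Module.finrank ℚ K - Real.log (w (x t : K))
  have hg0 : ∀ t w, 0 < g t w := fun t w => sub_pos.2 (hx t w)
  have hgsum : ∀ t, ∑ w, g t w = Real.log N - Real.log (∏ w : InfinitePlace K, w (x t : K)) := by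
    intro t
    rw [Real.log_prod fun w _ => (infinitePlace_pos w (hx0 t)).ne']
    simp only [g]
    rw [Finset.sum_sub_distrib, Finset.sum_add_distrib, Finset.sum_const, Finset.card_univ,
      card_infinitePlace_eq, nsmul_eq_mul, mul_div_cancel₀ _ hd, Nat.cast_sum, add_sub_cancel]
  have hnorm : ∀ t, ∏ w : InfinitePlace K, w (x t : K) ≤ N := by
    intro t
    have h1 := Finset.sum_nonneg fun w (_ : w ∈ Finset.univ) => (hg0 t w).le
    have h2 := one_le_prod_infinitePlace (hx0 t)
    rw [hgsum, sub_nonneg, Real.log_le_log_iff (by linarith) hN0] at h1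
    exact h1
  let key : (InfinitePlace K → ℕ) → ℕ × Ideal (𝓞 K) × (InfinitePlace K → ℕ) := fun t =>
    (∑ w, t w, Ideal.span {x t}, fun w => ⌊g t w⌋₊)
  have hkey : ∀ s t, key s = key t → ∀ w, |(s w - t w : ℝ) -
      (Real.log (w (x s : K)) - Real.log (w (x t : K)))| < 1 := by
    intro s t hst w
    obtain ⟨h1, -, h3⟩ : _ ∧ _ ∧ _ := by simpa only [key, Prod.mk.injEq] using hst
    have h := congrFun h3 w
    have hlt : |g s w - g t w| < 1 := by
      have h4 := Nat.floor_le (hg0 s w).le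
      have h5 := Nat.floor_le (hg0 t w).le
      have h6 := Nat.lt_floor_add_one (g s w)
      have h7 := Nat.lt_floor_add_one (g t w)
      rw [h] at h4 h6
      rw [abs_lt]
      constructor <;> linarith
    convert hlt using 2
    simp only [g, h1]
    ring
  let I := T.image fun t => Ideal.span {x t}
  let n := T.image fun t w => ⌊g t w⌋₊
  let R := Finset.range (Module.finrank ℚ K * (⌊Y⌋₊ - 1) + 1) ×ˢ I ×ˢ n
  have hmaps : ∀ t ∈ T, key t ∈ R := by
    intro t ht
    refine Finset.mem_product.2 ⟨Finset.mem_range.2 (Nat.lt_succ_of_le ?_), Finset.mem_product.2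
      ⟨Finset.mem_image_of_mem _ ht, Finset.mem_image.2 ⟨t, ht, rfl⟩⟩⟩
    refine (Finset.sum_le_card_nsmul _ _ (⌊Y⌋₊ - 1) fun w _ => ?_).trans ?_
    · have := hT t ht w
      lia
    · rw [Finset.card_univ, card_infinitePlace_eq, smul_eq_mul]
  have hfiber : ∀ k ∈ R, (T.filter fun t => key t = k).card ≤ (boundedUnits K Y).ncard := by
    intro k _
    rcases (T.filter fun t => key t = k).eq_empty_or_nonempty with h | ⟨s, hs⟩
    · rw [h, Finset.card_empty]
      exact Nat.zero_le _
    obtain ⟨hsT, rfl⟩ := Finset.mem_filter.1 hs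
    have hex : ∀ t, ∃ u : 𝓞 K, key t = key s → IsUnit u ∧ x t = x s * u := by
      intro t
      by_cases h : key t = key s
      · have h2 : Ideal.span {x s} = Ideal.span {x t} := (congrArg (fun k => k.2.1) h).symm
        obtain ⟨u, hu⟩ := Ideal.span_singleton_eq_span_singleton.1 h2
        exact ⟨u, fun _ => ⟨u.isUnit, hu.symm⟩⟩
      · exact ⟨0, fun h' => absurd h' h⟩
    choose u hu using hex
    rw [Set.ncard_eq_toFinset_card _ hfin]
    refine Finset.card_le_card_of_injOn u (fun t ht => ?_) fun t ht t' ht' h => ?_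
    · obtain ⟨htT, hk⟩ := Finset.mem_filter.1 ht
      obtain ⟨hunit, hmul⟩ := hu t hk
      refine hfin.mem_toFinset.2 ⟨hunit, fun w => ?_⟩
      have hlog : Real.log (w (x t : K)) = Real.log (w (x s : K)) + Real.log (w (u t : K)) := by
        rw [hmul, RingOfIntegers.coe_eq_algebraMap, map_mul, map_mul, Real.log_mul (infinitePlace_pos w (hx0 s)).ne'
          (infinitePlace_pos w hunit.ne_zero).ne']
      have h1 := abs_lt.1 (hkey t s hk w)
      rw [hlog] at h1
      have h2 : (t w + 1 : ℝ) ≤ ⌊Y⌋₊ := by exact_mod_cast hT t htT w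
      have h3 : (s w + 1 : ℝ) ≤ ⌊Y⌋₊ := by exact_mod_cast hT s hsT w
      have h4 : (⌊Y⌋₊ : ℝ) ≤ Y := Nat.floor_le (by linarith)
      have h5 : (0 : ℝ) ≤ t w := Nat.cast_nonneg _
      have h6 : (0 : ℝ) ≤ s w := Nat.cast_nonneg _
      rw [abs_le]
      constructor <;> linarith
    · obtain ⟨-, hk⟩ := Finset.mem_filter.1 ht
      obtain ⟨-, hk'⟩ := Finset.mem_filter.1 ht'
      have hxx : x t = x t' := by rw [(hu t hk).2, (hu t' hk').2, h]
      funext w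
      have h1 := hkey t t' (hk.trans hk'.symm) w
      rw [hxx, sub_self, sub_zero, abs_lt] at h1
      have h2 : (t w : ℝ) < t' w + 1 := by linarith
      have h3 : (t' w : ℝ) < t w + 1 := by linarith
      norm_cast at h2 h3
      lia
  have hI : (I.card : ℝ) ≤ N ^ 2 * 2 ^ Module.finrank ℚ K := by
    refine card_ideals_le K I fun J hJ => ?_
    obtain ⟨t, -, rfl⟩ := Finset.mem_image.1 hJ
    refine ⟨fun h => hx0 t (Ideal.span_singleton_eq_bot.1 h), ?_⟩
    rw [← prod_infinitePlace_eq]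
    exact hnorm t
  have hn : (n.card : ℝ) ≤ N * 2 ^ Module.finrank ℚ K := by
    rw [← card_infinitePlace_eq]
    refine card_le_mul_pow_of_one_le_mul_prod n (h := fun m => ((2 : ℝ)⁻¹) ^ m)
      (fun m => by positivity) sum_inv_two_pow_le_two hN0.le fun k hk => ?_
    obtain ⟨t, -, rfl⟩ := Finset.mem_image.1 hk
    rw [Finset.prod_pow_eq_pow_sum, inv_pow, ← div_eq_mul_inv, one_le_div (by positivity)]
    calc (2 : ℝ) ^ ∑ w, ⌊g t w⌋₊ ≤ Real.exp 1 ^ ∑ w, ⌊g t w⌋₊ := by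
          gcongr
          linarith [Real.exp_one_gt_d9]
      _ = Real.exp (∑ w, (⌊g t w⌋₊ : ℝ)) := by
          rw [← Real.exp_nat_mul, mul_one, Nat.cast_sum]
      _ ≤ Real.exp (Real.log N) := by
          refine Real.exp_le_exp.2 ((Finset.sum_le_sum fun w _ =>
            Nat.floor_le (hg0 t w).le).trans ?_)
          rw [hgsum, sub_le_self_iff]
          exact Real.log_nonneg (one_le_prod_infinitePlace (hx0 t))
      _ = N := Real.exp_log hN0
  have hcard := Finset.card_le_mul_card_image_of_maps_to hmaps _ hfiber
  have hTc : T.card = ⌊Y⌋₊ ^ Module.finrank ℚ K := by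
    simp [T, card_infinitePlace_eq]
  rw [hTc, Finset.card_product, Finset.card_product, Finset.card_range] at hcard
  have hcard' : (⌊Y⌋₊ : ℝ) ^ Module.finrank ℚ K ≤ (boundedUnits K Y).ncard *
      ((Module.finrank ℚ K * (⌊Y⌋₊ - 1) + 1) * (I.card * n.card)) := by
    have := (Nat.cast_le (α := ℝ)).2 hcard
    push_cast [Nat.cast_sub hm] at this
    exact this
  refine hcard'.trans ?_
  have : (0 : ℝ) ≤ ⌊Y⌋₊ - 1 := sub_nonneg.2 (by exact_mod_cast hm)
  rw [← mul_assoc (_ + 1 : ℝ)]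
  gcongr

theorem kfoldSumSet_boundedUnits_le {Y : ℝ} (hY : 0 ≤ Y) {k : ℕ} (hk : 1 ≤ k) :
    ((kfoldSumSet k (boundedUnits K Y)).ncard : ℝ) ≤
      (4 * (k * Real.exp Y)) ^ Module.finrank ℚ K := by
  have hk' : (1 : ℝ) ≤ k := by exact_mod_cast hk
  refine (ncard_integers_le (one_le_mul_of_one_le_of_one_le hk' (Real.one_le_exp hY)) ?_).2
  rintro _ ⟨f, hf, rfl⟩ w
  rw [← abs_realEmb, RingOfIntegers.coe_eq_algebraMap, map_sum, map_sum]
  refine (Finset.abs_sum_le_sum_abs _ _).trans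
    ((Finset.sum_le_card_nsmul _ _ (Real.exp Y) fun i _ => ?_).trans ?_)
  · rw [abs_realEmb, ← Real.log_le_iff_le_exp (infinitePlace_pos w (hf i).1.ne_zero)]
    exact (le_abs_self _).trans ((hf i).2 w)
  · simp

theorem kfoldProdSet_boundedUnits_le {Y : ℝ} (hY : 1 ≤ Y) {k : ℕ} (hk : 1 ≤ k) :
    ((kfoldProdSet k (boundedUnits K Y)).ncard : ℝ) ≤
      (16 * (k * Y)) ^ Module.finrank ℚ K := by
  have hk' : (1 : ℝ) ≤ k := by exact_mod_cast hk
  refine (ncard_units_le (one_le_mul_of_one_le_of_one_le hk' hY) ?_ ?_).2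
  · rintro _ ⟨f, hf, rfl⟩
    exact IsUnit.prod_univ_iff.2 fun i => (hf i).1
  · rintro _ ⟨f, hf, rfl⟩ w
    rw [RingOfIntegers.coe_eq_algebraMap, map_prod, map_prod, Real.log_prod fun i _ =>
      (infinitePlace_pos w (hf i).1.ne_zero).ne']
    refine (Finset.abs_sum_le_sum_abs _ _).trans
      ((Finset.sum_le_card_nsmul _ _ Y fun i _ => (hf i).2 w).trans ?_)
    simp

end

theorem isTotallyReal_of_totallyReal {K : Type*} [Field K] (h : TotallyReal K) :
    IsTotallyReal K where
  isReal _ := InfinitePlace.isReal_iff.2 <| ComplexEmbedding.isReal_iff.2 <| RingHom.ext fun x =>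
    Complex.conj_eq_iff_im.2 (h _ x)

/-- There exists an absolute constant `c > 0` such that for every totally real number
field `K` of degree `d ≥ 2` with (absolute) discriminant `Δ_K` and every `Y ≥ 2` there
exists `A ⊆ 𝓞 K` with `(cY)^d / (Y Δ_K^{3/2}) ≤ |A| ≤ (Y/c)^d` and
`max(|kA|, |A^{(k)}|) ≤ (k e^Y / c)^d` for every `k ≥ 2`. -/
theorem statement16 :
    ∃ c : ℝ, 0 < c ∧
      ∀ (K : Type) (_ : Field K) (_ : NumberField K), TotallyReal K →
        ∀ d : ℕ, Module.finrank ℚ K = d → 2 ≤ d →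
          ∀ Y : ℝ, 2 ≤ Y →
            ∃ A : Set (𝓞 K), A.Finite ∧
              (c * Y) ^ d /
                  (Y * ((NumberField.discr K).natAbs : ℝ) ^ ((3 : ℝ) / 2)) ≤
                (A.ncard : ℝ) ∧
              (A.ncard : ℝ) ≤ (Y / c) ^ d ∧
              ∀ k : ℕ, 2 ≤ k →
                max ((kfoldSumSet k A).ncard : ℝ) ((kfoldProdSet k A).ncard : ℝ) ≤
                  ((k : ℝ) * Real.exp Y / c) ^ d := by
  refine ⟨1 / 128, by norm_num, fun K _ _ hK d hd hd2 Y hY => ?_⟩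
  have := isTotallyReal_of_totallyReal hK
  have hY1 : 1 ≤ Y := by linarith
  obtain ⟨hfin, hle⟩ := ncard_units_le (S := boundedUnits K Y) hY1 (fun x hx => hx.1)
    fun x hx => hx.2
  refine ⟨boundedUnits K Y, hfin, ?_, ?_, fun k hk => max_le ?_ ?_⟩
  · have hD0 : (0 : ℝ) < |(discr K : ℝ)| := abs_pos.2 (Int.cast_ne_zero.2 (discr_ne_zero K))
    rw [Nat.cast_natAbs, Int.cast_abs]
    set D := |(discr K : ℝ)|
    have hs : 0 < √D := Real.sqrt_pos.2 hD0
    have hN : √D < 2 ^ d * √D := lt_mul_of_one_lt_left hs (one_lt_pow₀ one_lt_two (by lia))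
    have h := pow_floor_le_ncard_boundedUnits hN hY1
    rw [hd] at h
    have hD : D ^ ((3 : ℝ) / 2) = √D ^ 3 := by
      rw [Real.sqrt_eq_rpow, ← Real.rpow_natCast, ← Real.rpow_mul hD0.le]
      norm_num
    have hm : (1 : ℝ) ≤ ⌊Y⌋₊ := by exact_mod_cast (Nat.one_le_floor_iff _).2 hY1
    have hmY : (⌊Y⌋₊ : ℝ) ≤ Y := Nat.floor_le (by linarith)
    have hYm : Y / 2 ≤ ⌊Y⌋₊ := by linarith [Nat.lt_floor_add_one Y]
    have hd' : (d : ℝ) ≤ 2 ^ d := by exact_mod_cast Nat.lt_two_pow_self.le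
    have hd1 : (2 : ℝ) ≤ d := by exact_mod_cast hd2
    have hlin : (d * (⌊Y⌋₊ - 1) + 1 : ℝ) ≤ 2 ^ d * Y := by nlinarith
    rw [hD, div_le_iff₀ (by positivity)]
    have h128 : (1 / 128 * Y) ^ d = (Y / 2) ^ d / 64 ^ d := by
      rw [← div_pow]
      ring
    rw [h128, div_le_iff₀ (by positivity)]
    calc (Y / 2) ^ d ≤ (⌊Y⌋₊ : ℝ) ^ d := by gcongr
      _ ≤ _ := h
      _ ≤ (boundedUnits K Y).ncard * (2 ^ d * Y * ((2 ^ d * √D) ^ 2 * 2 ^ d) *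
            (2 ^ d * √D * 2 ^ d)) := by gcongr
      _ = (boundedUnits K Y).ncard * (Y * √D ^ 3) * 64 ^ d := by
          rw [show (64 : ℝ) = 2 ^ 6 by norm_num, ← pow_mul, mul_comm 6 d, pow_mul]
          ring
  · rw [hd] at hle
    refine hle.trans (pow_le_pow_left₀ (by linarith) ?_ d)
    linarith
  · refine (kfoldSumSet_boundedUnits_le (by linarith) (by lia)).trans ?_
    rw [hd]
    refine pow_le_pow_left₀ (by positivity) ?_ d
    have : 0 ≤ (k : ℝ) * Real.exp Y := by positivity
    linarith
  · refine (kfoldProdSet_boundedUnits_le hY1 (by lia)).trans ?_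
    rw [hd]
    refine pow_le_pow_left₀ (by positivity) ?_ d
    have h1 : (k : ℝ) * Y ≤ k * Real.exp Y := by
      gcongr
      linarith [Real.add_one_le_exp Y]
    have : 0 ≤ (k : ℝ) * Real.exp Y := by positivity
    linarith
end
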